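/- Let n ≥ 1 be a natural number, M > 0, and let θ : ℝ → ℝ be differentiable with |θ'(t)| ≤ M for all t and with θ'(t) = 0 whenever t ≤ 1 or t ≥ 4. Let 0 < λ ≤ 1 and b > 0. Define β on n-dimensional Euclidean space by β(u) = θ((‖u‖/(4b))^λ). Then β is differentiable at every u ≠ 0 and the operator norm of its derivative satisfies ‖Dβ(u)‖ ≤ 4·M·λ/‖u‖. -/

import Mathlib

/-- Gradient bound for a radial function `v ↦ f ((‖v‖ / c) ^ p)` away from the origin. -/
theorem differentiableAt_and_norm_fderiv_comp_norm_div_rpow_le {E : Type*}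
    [NormedAddCommGroup E] [InnerProductSpace ℝ E] {f : ℝ → ℝ} {c p : ℝ} {u : E}
    (hc : 0 < c) (hp : 0 ≤ p) (hu : u ≠ 0)
    (hf : DifferentiableAt ℝ f ((‖u‖ / c) ^ p)) :
    DifferentiableAt ℝ (fun v : E => f ((‖v‖ / c) ^ p)) u ∧
      ‖fderiv ℝ (fun v : E => f ((‖v‖ / c) ^ p)) u‖ ≤
        |deriv f ((‖u‖ / c) ^ p)| * (‖u‖ / c) ^ p * p / ‖u‖ := by
  have hu' : 0 < ‖u‖ := norm_pos_iff.2 hu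
  have hr : 0 < ‖u‖ / c := div_pos hu' hc
  have hnorm : HasFDerivAt (fun v : E => ‖v‖) (fderiv ℝ (fun v : E => ‖v‖) u) u :=
    (differentiableAt_id.norm ℝ hu).hasFDerivAt
  have hle : ‖fderiv ℝ (fun v : E => ‖v‖) u‖ ≤ 1 :=
    mod_cast norm_fderiv_le_of_lipschitz ℝ (lipschitzWith_one_norm (E := E)) (x₀ := u)
  have hpow : HasDerivAt (fun t : ℝ => (t / c) ^ p) (1 / c * p * (‖u‖ / c) ^ (p - 1)) ‖u‖ :=
    ((hasDerivAt_id ‖u‖).div_const c).rpow_const (Or.inl hr.ne')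
  have hcomp := (hf.hasDerivAt.comp ‖u‖ hpow).comp_hasFDerivAt u hnorm
  have hderiv : HasFDerivAt (fun v : E => f ((‖v‖ / c) ^ p)) _ u := hcomp
  refine ⟨hderiv.differentiableAt, ?_⟩
  have hcoef : 1 / c * p * (‖u‖ / c) ^ (p - 1) = (‖u‖ / c) ^ p * p / ‖u‖ := by
    rw [Real.rpow_sub_one hr.ne']
    field_simp
  have hnonneg : 0 ≤ (‖u‖ / c) ^ p * p / ‖u‖ := by positivity
  rw [hderiv.fderiv, norm_smul, hcoef, Real.norm_eq_abs, abs_mul, abs_of_nonneg hnonneg]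
  calc _ ≤ |deriv f ((‖u‖ / c) ^ p)| * ((‖u‖ / c) ^ p * p / ‖u‖) * 1 := by gcongr
    _ = _ := by ring


/-- Gradient bound for the logarithmic cut-off function `β(u) = θ((‖u‖/(4b))^λ)`:
`‖Dβ(u)‖ ≤ 4 M λ / ‖u‖` for `u ≠ 0`. -/
theorem cutoff_gradient_bound (n : ℕ) (hn : 1 ≤ n) (M : ℝ) (hM : 0 < M)
    (θ : ℝ → ℝ) (hθ : Differentiable ℝ θ) (hθ' : ∀ t, |deriv θ t| ≤ M)
    (hθ'0 : ∀ t, t ≤ 1 ∨ 4 ≤ t → deriv θ t = 0)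
    (lam b : ℝ) (hlam0 : 0 < lam) (hlam1 : lam ≤ 1) (hb : 0 < b)
    (β : EuclideanSpace ℝ (Fin n) → ℝ)
    (hβ : ∀ u, β u = θ ((‖u‖ / (4 * b)) ^ lam))
    (u : EuclideanSpace ℝ (Fin n)) (hu : u ≠ 0) :
    DifferentiableAt ℝ β u ∧ ‖fderiv ℝ β u‖ ≤ 4 * M * lam / ‖u‖ := by
  obtain rfl : β = fun v => θ ((‖v‖ / (4 * b)) ^ lam) := funext hβ
  obtain ⟨hdiff, hle⟩ := differentiableAt_and_norm_fderiv_comp_norm_div_rpow_le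
    (mul_pos four_pos hb) hlam0.le hu (hθ ((‖u‖ / (4 * b)) ^ lam))
  refine ⟨hdiff, hle.trans ?_⟩
  have hs : 0 ≤ (‖u‖ / (4 * b)) ^ lam := by positivity
  have key : |deriv θ ((‖u‖ / (4 * b)) ^ lam)| * (‖u‖ / (4 * b)) ^ lam ≤ 4 * M := by
    rcases le_total 4 ((‖u‖ / (4 * b)) ^ lam) with h | h
    · rw [hθ'0 _ (Or.inr h), abs_zero, zero_mul]
      positivity
    · rw [mul_comm 4 M]
      exact mul_le_mul (hθ' _) h hs hM.le
  gcongr
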